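/- arXiv:2410.04031 — 2 statements merged into one kernel-verified Lean document; each statement's English description precedes it below -/
import Mathlib

section
/- Let n ≥ 1 and 1 < p < ∞, and let w be a weight on ℝⁿ with w ∈ A_p^*. Then there is a constant C depending only on n and p such that for every f ∈ L^p(w), ‖w^{1/p}·Mf‖_{L^{p,∞}} ≤ C·([w]_{A_p^*}^{p'})^{1/p}·‖f‖_{L^p(w)}; that is, the multiplier weak-type (p,p) inequality for the Hardy–Littlewood maximal operator holds with constant C·[w]_{A_p^*}^{p'/p}. -/
open MeasureTheory Set
open scoped ENNReal

noncomputable section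

/-- An axis-parallel cube in `ℝⁿ` (realized as `Fin n → ℝ`) with positive finite side length. -/
def IsCube (n : ℕ) (Q : Set (Fin n → ℝ)) : Prop :=
  ∃ (a : Fin n → ℝ) (h : ℝ), 0 < h ∧ Q = Set.univ.pi fun i => Set.Icc (a i) (a i + h)

/-- The weak `L^p` quasinorm `sup_{t>0} t · |{x : g x > t}|^{1/p}` of an `ℝ≥0∞`-valued
function on `ℝⁿ`. -/
def wnormE (n : ℕ) (p : ℝ) (g : (Fin n → ℝ) → ℝ≥0∞) : ℝ≥0∞ :=
  ⨆ (t : ℝ) (_ : 0 < t), ENNReal.ofReal t * volume {x | ENNReal.ofReal t < g x} ^ (1 / p)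

/-- The Hardy–Littlewood maximal operator: supremum of averages of `|f|` over cubes
containing `x`. -/
def maximalFn (n : ℕ) (f : (Fin n → ℝ) → ℝ) (x : Fin n → ℝ) : ℝ≥0∞ :=
  ⨆ (Q : Set (Fin n → ℝ)) (_ : IsCube n Q) (_ : x ∈ Q),
    (volume Q)⁻¹ * ∫⁻ y in Q, ENNReal.ofReal |f y|

/-- The fractional maximal operator `M_α`. -/
def fracMaximalFn (n : ℕ) (α : ℝ) (f : (Fin n → ℝ) → ℝ) (x : Fin n → ℝ) : ℝ≥0∞ :=
  ⨆ (Q : Set (Fin n → ℝ)) (_ : IsCube n Q) (_ : x ∈ Q),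
    volume Q ^ (α / (n : ℝ)) * ((volume Q)⁻¹ * ∫⁻ y in Q, ENNReal.ofReal |f y|)

/-- The multiplier `A_p^*` characteristic
`[w]_{A_p^*} = sup_Q (|Q|⁻¹·‖w·χ_Q‖_{L^{1,∞}})·(⨍_Q w^{1-p'})^{p-1}`, with `p' = p/(p-1)`. -/
def ApStarConst (n : ℕ) (p : ℝ) (w : (Fin n → ℝ) → ℝ) : ℝ≥0∞ :=
  ⨆ (Q : Set (Fin n → ℝ)) (_ : IsCube n Q),
    (volume Q)⁻¹ * wnormE n 1 (Q.indicator fun x => ENNReal.ofReal (w x)) *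
      ((volume Q)⁻¹ * ∫⁻ x in Q, ENNReal.ofReal (w x ^ (1 - p / (p - 1)))) ^ (p - 1)

/-- The multiplier `A_{p,q}^*` characteristic
`[w]_{A_{p,q}^*} = sup_Q (|Q|⁻¹·‖w^q·χ_Q‖_{L^{1,∞}})^{1/q}·(⨍_Q w^{-p'})^{1/p'}`,
with `p' = p/(p-1)` and `1/p' = 1 - 1/p`. -/
def ApqStarConst (n : ℕ) (p q : ℝ) (w : (Fin n → ℝ) → ℝ) : ℝ≥0∞ :=
  ⨆ (Q : Set (Fin n → ℝ)) (_ : IsCube n Q),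
    ((volume Q)⁻¹ * wnormE n 1 (Q.indicator fun x => ENNReal.ofReal (w x ^ q))) ^ (1 / q) *
      ((volume Q)⁻¹ * ∫⁻ x in Q, ENNReal.ofReal (w x ^ (-(p / (p - 1))))) ^ (1 - 1 / p)

/-- The Muckenhoupt `A_p` characteristic `[w]_{A_p} = sup_Q (⨍_Q w)·(⨍_Q w^{1-p'})^{p-1}`. -/
def ApConst (n : ℕ) (p : ℝ) (w : (Fin n → ℝ) → ℝ) : ℝ≥0∞ :=
  ⨆ (Q : Set (Fin n → ℝ)) (_ : IsCube n Q),
    ((volume Q)⁻¹ * ∫⁻ x in Q, ENNReal.ofReal (w x)) *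
      ((volume Q)⁻¹ * ∫⁻ x in Q, ENNReal.ofReal (w x ^ (1 - p / (p - 1)))) ^ (p - 1)

/-- The Muckenhoupt `A_{p,q}` characteristic
`[w]_{A_{p,q}} = sup_Q (⨍_Q w^q)^{1/q}·(⨍_Q w^{-p'})^{1/p'}`. -/
def ApqConst (n : ℕ) (p q : ℝ) (w : (Fin n → ℝ) → ℝ) : ℝ≥0∞ :=
  ⨆ (Q : Set (Fin n → ℝ)) (_ : IsCube n Q),
    ((volume Q)⁻¹ * ∫⁻ x in Q, ENNReal.ofReal (w x ^ q)) ^ (1 / q) *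
      ((volume Q)⁻¹ * ∫⁻ x in Q, ENNReal.ofReal (w x ^ (-(p / (p - 1))))) ^ (1 - 1 / p)

lemma vitali_weak {n : ℕ} {ι : Type*} (μ : Measure (Fin n → ℝ)) (h : (Fin n → ℝ) → ℝ≥0∞)
    (T : Set ι) (c : ι → (Fin n → ℝ)) (r : ι → ℝ) (R : ℝ)
    (hr : ∀ a ∈ T, 0 < r a ∧ r a ≤ R) (τ : ℝ≥0∞)
    (ht : ∀ a ∈ T, τ * μ (Metric.closedBall (c a) (5 * r a)) ≤
      ∫⁻ y in Metric.closedBall (c a) (r a), h y ∂μ)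
    (U : Set (Fin n → ℝ)) (hU : ∀ a ∈ T, Metric.closedBall (c a) (r a) ⊆ U) :
    τ * μ (⋃ a ∈ T, Metric.closedBall (c a) (r a)) ≤ ∫⁻ y in U, h y ∂μ := by
  obtain ⟨u, huT, hdisj, hcov⟩ := Vitali.exists_disjoint_subfamily_covering_enlargement_closedBall
    T c r R (fun a ha => (hr a ha).2) 5 (by norm_num)
  have hc : u.Countable := hdisj.countable_of_nonempty_interior fun a ha =>
    (Metric.nonempty_ball.2 (hr a (huT ha)).1).mono Metric.ball_subset_interior_closedBall
  have h1 : (⋃ a ∈ T, Metric.closedBall (c a) (r a)) ⊆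
      ⋃ b ∈ u, Metric.closedBall (c b) (5 * r b) := by
    refine iUnion₂_subset fun a ha => ?_
    obtain ⟨b, hb, hab⟩ := hcov a ha
    exact hab.trans (subset_biUnion_of_mem (u := fun b => Metric.closedBall (c b) (5 * r b)) hb)
  calc τ * μ (⋃ a ∈ T, Metric.closedBall (c a) (r a))
      ≤ τ * ∑' b : u, μ (Metric.closedBall (c b) (5 * r b)) := by
        gcongr
        exact (measure_mono h1).trans (measure_biUnion_le μ hc _)
    _ = ∑' b : u, τ * μ (Metric.closedBall (c b) (5 * r b)) := ENNReal.tsum_mul_left.symm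
    _ ≤ ∑' b : u, ∫⁻ y in Metric.closedBall (c b) (r b), h y ∂μ :=
        ENNReal.tsum_le_tsum fun b => ht b (huT b.2)
    _ = ∫⁻ y in ⋃ b ∈ u, Metric.closedBall (c b) (r b), h y ∂μ :=
        (lintegral_biUnion hc (fun b _ => Metric.isClosed_closedBall.measurableSet) hdisj _).symm
    _ ≤ ∫⁻ y in U, h y ∂μ :=
        lintegral_mono_set (iUnion₂_subset fun b hb => hU b (huT hb))

lemma lint_rpow (q a : ℝ) (hq : 0 < q) (ha : 0 ≤ a) :
    ∫⁻ t in Ioo 0 a, ENNReal.ofReal (t ^ (q - 1)) = ENNReal.ofReal (a ^ q / q) := by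
  have hi : IntervalIntegrable (fun t : ℝ => t ^ (q - 1)) volume 0 a :=
    intervalIntegral.intervalIntegrable_rpow' (by linarith)
  rw [← setLIntegral_congr Ioo_ae_eq_Ioc.symm, ← ofReal_integral_eq_lintegral_ofReal,
    ← intervalIntegral.integral_of_le ha, integral_rpow (Or.inl (by linarith))]
  · rw [sub_add_cancel, Real.zero_rpow hq.ne', sub_zero]
  · exact (intervalIntegrable_iff_integrableOn_Ioc_of_le ha).1 hi
  · filter_upwards [ae_restrict_mem measurableSet_Ioc] with t ht
    exact Real.rpow_nonneg ht.1.le _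

/-- Marcinkiewicz-type inequality for finite families. -/
lemma carleson_fin {n : ℕ} {ι : Type*} (p : ℝ) (hp : 1 < p) (σ : Measure (Fin n → ℝ)) [SFinite σ]
    (g : (Fin n → ℝ) → ℝ) (hg : Measurable g) (hg0 : ∀ x, 0 ≤ g x)
    (J : Finset ι) (c : ι → (Fin n → ℝ)) (r : ι → ℝ) (hr : ∀ j ∈ J, 0 < r j)
    (E : ι → Set (Fin n → ℝ)) (hE : ∀ j, MeasurableSet (E j))
    (hEQ : ∀ j, E j ⊆ Metric.closedBall (c j) (r j))
    (hd : (J : Set ι).PairwiseDisjoint E)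
    (a : ι → ℝ) (ha : ∀ j, 0 ≤ a j)
    (hfin : ∀ j, σ (Metric.closedBall (c j) (5 * r j)) ≠ ∞)
    (haj : ∀ j ∈ J, ENNReal.ofReal (a j) * σ (Metric.closedBall (c j) (5 * r j)) ≤
      ∫⁻ y in Metric.closedBall (c j) (r j), ENNReal.ofReal (g y) ∂σ) :
    ∑ j ∈ J, σ (E j) * ENNReal.ofReal (a j ^ p) ≤
      ENNReal.ofReal (p / (p - 1) * 2 ^ p) * ∫⁻ y, ENNReal.ofReal (g y ^ p) ∂σ := by
  classical
  have hp0 : 0 < p := by linarith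
  -- level estimate
  have hlev : ∀ t : ℝ, 0 < t → ∑ j ∈ J, (if t < a j then σ (E j) else 0) ≤
      ENNReal.ofReal (2 / t) * ∫⁻ y, (if t < 2 * g y then ENNReal.ofReal (g y) else 0) ∂σ := by
    intro t ht
    set h : (Fin n → ℝ) → ℝ≥0∞ := fun y => if t < 2 * g y then ENNReal.ofReal (g y) else 0 with hh
    have hmeas : Measurable h := Measurable.ite (measurableSet_lt measurable_const (by fun_prop))
      (by fun_prop) measurable_const
    let T : Set ι := {j | j ∈ J ∧ t < a j}
    have hRb : ∃ R, ∀ j ∈ J, r j ≤ R := by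
      obtain ⟨R, hR⟩ := (J.image r).bddAbove
      exact ⟨R, fun j hj => hR (by simpa using ⟨j, hj, rfl⟩)⟩
    obtain ⟨R, hR⟩ := hRb
    have hw := vitali_weak σ h T c r R (fun j hj => ⟨hr j hj.1, hR j hj.1⟩) (ENNReal.ofReal (t / 2))
      (by
        intro j hj
        have h1 : ENNReal.ofReal t * σ (Metric.closedBall (c j) (5 * r j)) ≤
            ENNReal.ofReal (t / 2) * σ (Metric.closedBall (c j) (5 * r j)) +
            ∫⁻ y in Metric.closedBall (c j) (r j), h y ∂σ := by
          calc _ ≤ ENNReal.ofReal (a j) * σ (Metric.closedBall (c j) (5 * r j)) := by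
                gcongr; exact hj.2.le
            _ ≤ ∫⁻ y in Metric.closedBall (c j) (r j), ENNReal.ofReal (g y) ∂σ := haj j hj.1
            _ ≤ ∫⁻ y in Metric.closedBall (c j) (r j), (ENNReal.ofReal (t / 2) + h y) ∂σ := by
                refine lintegral_mono fun y => ?_
                simp only [hh]
                split_ifs with hy
                · exact le_add_self
                · rw [add_zero]
                  exact ENNReal.ofReal_le_ofReal (by linarith)
            _ = ENNReal.ofReal (t / 2) * σ (Metric.closedBall (c j) (r j)) +
                ∫⁻ y in Metric.closedBall (c j) (r j), h y ∂σ := by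
                rw [lintegral_add_left measurable_const, setLIntegral_const]
            _ ≤ _ := by
                gcongr
                linarith [hr j hj.1]
        have h2 : ENNReal.ofReal t = ENNReal.ofReal (t / 2) + ENNReal.ofReal (t / 2) := by
          rw [← ENNReal.ofReal_add (by positivity) (by positivity)]; congr 1; ring
        rw [h2, add_mul] at h1
        exact (ENNReal.add_le_add_iff_left (ENNReal.mul_ne_top ENNReal.ofReal_ne_top (hfin j))).1 h1)
      univ (fun _ _ => subset_univ _)
    rw [Measure.restrict_univ] at hw
    have h3 : ∑ j ∈ J, (if t < a j then σ (E j) else 0) ≤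
        σ (⋃ j ∈ T, Metric.closedBall (c j) (r j)) := by
      rw [← Finset.sum_filter, ← measure_biUnion_finset]
      · refine measure_mono (iUnion₂_subset fun j hj => ?_)
        rw [Finset.mem_filter] at hj
        exact (hEQ j).trans
          (subset_biUnion_of_mem (u := fun b => Metric.closedBall (c b) (r b)) (show j ∈ T from hj))
      · exact hd.subset (by intro j hj; simp at hj; exact hj.1)
      · exact fun j _ => hE j
    have h4 : ENNReal.ofReal (2 / t) * ENNReal.ofReal (t / 2) = 1 := by
      rw [← ENNReal.ofReal_mul (by positivity)]
      rw [show 2 / t * (t / 2) = 1 by field_simp, ENNReal.ofReal_one]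
    calc _ ≤ σ (⋃ j ∈ T, Metric.closedBall (c j) (r j)) := h3
      _ = ENNReal.ofReal (2 / t) * (ENNReal.ofReal (t / 2) *
          σ (⋃ j ∈ T, Metric.closedBall (c j) (r j))) := by rw [← mul_assoc, h4, one_mul]
      _ ≤ _ := by gcongr
  have hstep : ∀ j, σ (E j) * ENNReal.ofReal (a j ^ p) =
      ∫⁻ t in Ioi (0 : ℝ), ENNReal.ofReal (p * t ^ (p - 1)) * (if t < a j then σ (E j) else 0) := by
    intro j
    have h1 : ∀ t : ℝ, ENNReal.ofReal (p * t ^ (p - 1)) * (if t < a j then σ (E j) else 0)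
        = (Iio (a j)).indicator
          (fun t => ENNReal.ofReal p * σ (E j) * ENNReal.ofReal (t ^ (p - 1))) t := by
      intro t
      by_cases h : t < a j
      · rw [if_pos h, indicator_of_mem (show t ∈ Iio (a j) from h), ENNReal.ofReal_mul hp0.le]; ring
      · rw [if_neg h, indicator_of_notMem (show t ∉ Iio (a j) from h), mul_zero]
    simp_rw [h1]
    rw [lintegral_indicator measurableSet_Iio, Measure.restrict_restrict measurableSet_Iio,
      Iio_inter_Ioi, lintegral_const_mul _ (by fun_prop), lint_rpow p _ hp0 (ha j),
      ENNReal.ofReal_div_of_pos hp0]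
    rw [mul_assoc, mul_comm (ENNReal.ofReal p), mul_assoc,
      ENNReal.div_mul_cancel (by simpa using hp0) ENNReal.ofReal_ne_top]
  calc ∑ j ∈ J, σ (E j) * ENNReal.ofReal (a j ^ p)
      = ∫⁻ t in Ioi (0 : ℝ), ∑ j ∈ J, ENNReal.ofReal (p * t ^ (p - 1)) *
          (if t < a j then σ (E j) else 0) := by
        rw [lintegral_finsetSum]
        · exact Finset.sum_congr rfl fun j _ => hstep j
        · intro j _
          exact Measurable.mul (by fun_prop)
            (Measurable.ite measurableSet_Iio measurable_const measurable_const)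
    _ ≤ ∫⁻ t in Ioi (0 : ℝ), ∫⁻ y, ENNReal.ofReal (2 * p * t ^ (p - 1 - 1)) *
          (if t < 2 * g y then ENNReal.ofReal (g y) else 0) ∂σ := by
        refine setLIntegral_mono' measurableSet_Ioi fun t ht => ?_
        have ht : 0 < t := ht
        rw [← Finset.mul_sum, lintegral_const_mul]
        · calc _ ≤ ENNReal.ofReal (p * t ^ (p - 1)) * (ENNReal.ofReal (2 / t) *
                ∫⁻ y, (if t < 2 * g y then ENNReal.ofReal (g y) else 0) ∂σ) := by
                gcongr; exact hlev t ht
            _ = _ := by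
                rw [← mul_assoc, ← ENNReal.ofReal_mul (by positivity)]
                congr 2
                rw [Real.rpow_sub_one ht.ne' (p - 1)]; field_simp
        · exact Measurable.ite (measurableSet_lt measurable_const (by fun_prop))
            (by fun_prop) measurable_const
    _ = ∫⁻ y, (∫⁻ t in Ioi (0 : ℝ), ENNReal.ofReal (2 * p * t ^ (p - 1 - 1)) *
          (if t < 2 * g y then ENNReal.ofReal (g y) else 0)) ∂σ := by
        refine lintegral_lintegral_swap (Measurable.aemeasurable ?_)
        refine Measurable.mul (by fun_prop) (Measurable.ite ?_ (by fun_prop) measurable_const)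
        exact measurableSet_lt (by fun_prop) (by fun_prop)
    _ = ∫⁻ y, ENNReal.ofReal (p / (p - 1) * 2 ^ p) * ENNReal.ofReal (g y ^ p) ∂σ := by
        refine lintegral_congr fun y => ?_
        have h1 : ∀ t : ℝ, ENNReal.ofReal (2 * p * t ^ (p - 1 - 1)) *
          (if t < 2 * g y then ENNReal.ofReal (g y) else 0)
            = (Iio (2 * g y)).indicator
          (fun t => ENNReal.ofReal (2 * p * g y) * ENNReal.ofReal (t ^ (p - 1 - 1))) t := by
          intro t
          by_cases h : t < 2 * g y
          · rw [if_pos h, indicator_of_mem (show t ∈ Iio (2 * g y) from h),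
              ENNReal.ofReal_mul (by positivity), ENNReal.ofReal_mul (p := 2 * p) (by positivity)]
            ring
          · rw [if_neg h, indicator_of_notMem (show t ∉ Iio (2 * g y) from h), mul_zero]
        simp_rw [h1]
        have hgy := hg0 y
        rw [lintegral_indicator measurableSet_Iio, Measure.restrict_restrict measurableSet_Iio,
          Iio_inter_Ioi, lintegral_const_mul _ (by fun_prop),
          lint_rpow (p - 1) _ (by linarith) (by positivity),
          ← ENNReal.ofReal_mul (by positivity), ← ENNReal.ofReal_mul]
        · congr 1
          rcases hgy.eq_or_lt with h0 | h0
          · rw [← h0, Real.zero_rpow hp0.ne']; ring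
          · rw [Real.mul_rpow (by norm_num) hgy, Real.rpow_sub_one two_ne_zero,
              Real.rpow_sub_one h0.ne']
            field_simp
        · have : 0 < p - 1 := by linarith
          positivity
    _ = _ := lintegral_const_mul _ (by fun_prop)

lemma isCube_closedBall {n : ℕ} (c : Fin n → ℝ) {r : ℝ} (hr : 0 < r) :
    IsCube n (Metric.closedBall c r) := by
  refine ⟨fun i => c i - r, 2 * r, by positivity, ?_⟩
  rw [closedBall_pi _ hr.le]
  congr 1
  ext i : 1
  rw [Real.closedBall_eq_Icc]
  congr 1
  ring

lemma IsCube.exists_ball {n : ℕ} {Q : Set (Fin n → ℝ)} (hQ : IsCube n Q) :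
    ∃ (c : Fin n → ℝ) (r : ℝ), 0 < r ∧ Q = Metric.closedBall c r := by
  obtain ⟨a, h, hh, rfl⟩ := hQ
  refine ⟨fun i => a i + h / 2, h / 2, by positivity, ?_⟩
  rw [closedBall_pi _ (by positivity)]
  congr 1
  ext i : 1
  rw [Real.closedBall_eq_Icc]
  congr 1 <;> ring

lemma vol_ball_mul {n : ℕ} (c : Fin n → ℝ) {k r : ℝ} (hk : 0 ≤ k) (hr : 0 ≤ r) :
    volume (Metric.closedBall c (k * r)) =
      ENNReal.ofReal k ^ n * volume (Metric.closedBall c r) := by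
  rw [Real.volume_pi_closedBall _ (by positivity), Real.volume_pi_closedBall _ hr,
    ← ENNReal.ofReal_pow hk, ← ENNReal.ofReal_mul (by positivity)]
  congr 1
  rw [Fintype.card_fin, ← mul_pow]
  congr 1
  ring

lemma vol_ball_ne_zero {n : ℕ} (c : Fin n → ℝ) {r : ℝ} (hr : 0 < r) :
    volume (Metric.closedBall c r) ≠ 0 := (Metric.measure_closedBall_pos _ c hr).ne'

lemma vol_ball_ne_top {n : ℕ} (c : Fin n → ℝ) (r : ℝ) :
    volume (Metric.closedBall c r) ≠ ∞ := measure_closedBall_lt_top.ne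

lemma lt_maximalFn {n : ℕ} {f : (Fin n → ℝ) → ℝ} {x : Fin n → ℝ} {τ : ℝ≥0∞} :
    τ < maximalFn n f x ↔ ∃ (c : Fin n → ℝ) (r : ℝ), 0 < r ∧ x ∈ Metric.closedBall c r ∧
      τ * volume (Metric.closedBall c r) < ∫⁻ y in Metric.closedBall c r, ENNReal.ofReal |f y| := by
  unfold maximalFn
  simp only [lt_iSup_iff]
  constructor
  · rintro ⟨Q, hQ, hx, h⟩
    obtain ⟨c, r, hr, rfl⟩ := hQ.exists_ball
    refine ⟨c, r, hr, hx, ?_⟩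
    rw [mul_comm, ← div_eq_mul_inv] at h
    exact (ENNReal.lt_div_iff_mul_lt (Or.inl (vol_ball_ne_zero c hr))
      (Or.inl (vol_ball_ne_top c r))).1 h
  · rintro ⟨c, r, hr, hx, h⟩
    refine ⟨_, isCube_closedBall c hr, hx, ?_⟩
    rw [mul_comm, ← div_eq_mul_inv]
    exact (ENNReal.lt_div_iff_mul_lt (Or.inl (vol_ball_ne_zero c hr))
      (Or.inl (vol_ball_ne_top c r))).2 h

lemma le_of_maximalFn_le {n : ℕ} {f : (Fin n → ℝ) → ℝ} {x : Fin n → ℝ} {τ : ℝ≥0∞}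
    (h : maximalFn n f x ≤ τ) (c : Fin n → ℝ) (r : ℝ) (hr : 0 < r)
    (hx : x ∈ Metric.closedBall c r) :
    ∫⁻ y in Metric.closedBall c r, ENNReal.ofReal |f y| ≤ τ * volume (Metric.closedBall c r) := by
  by_contra hc
  exact absurd (lt_maximalFn.2 ⟨c, r, hr, hx, not_le.1 hc⟩) (not_lt.2 h)

lemma local_weak {n : ℕ} (f : (Fin n → ℝ) → ℝ) (c : Fin n → ℝ) (r : ℝ) (hr : 0 < r)
    (x : Fin n → ℝ) (hx : x ∈ Metric.closedBall c r) (τ : ℝ≥0∞) (h0 : τ ≠ 0) (htop : τ ≠ ∞)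
    (hM : maximalFn n f x ≤ τ) :
    2 * volume (Metric.closedBall c r ∩ {y | 2 * 15 ^ n * τ < maximalFn n f y}) ≤
      volume (Metric.closedBall c r) := by
  set S := Metric.closedBall c r ∩ {y | 2 * 15 ^ n * τ < maximalFn n f y} with hS
  have h1 : ∀ y : S, ∃ (d : Fin n → ℝ) (ρ : ℝ), 0 < ρ ∧ (y : Fin n → ℝ) ∈ Metric.closedBall d ρ ∧
      2 * 15 ^ n * τ * volume (Metric.closedBall d ρ) <
        ∫⁻ z in Metric.closedBall d ρ, ENNReal.ofReal |f z| :=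
    fun y => lt_maximalFn.1 y.2.2
  choose d ρ hρ hy hav using h1
  have hsmall : ∀ y : S, ρ y ≤ r := by
    intro y
    by_contra hlt
    push Not at hlt
    have hx3 : x ∈ Metric.closedBall (d y) (3 * ρ y) := by
      have e1 := Metric.mem_closedBall.1 hx
      have e2 := Metric.mem_closedBall.1 (hy y)
      have e3 := Metric.mem_closedBall'.1 y.2.1
      have e4 := dist_triangle4 x c y (d y)
      rw [Metric.mem_closedBall]
      linarith
    have e5 := le_of_maximalFn_le hM _ _ (by have := hρ y; positivity) hx3
    rw [vol_ball_mul _ (by norm_num) (hρ y).le] at e5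
    have e6 : ∫⁻ z in Metric.closedBall (d y) (ρ y), ENNReal.ofReal |f z| ≤
        ∫⁻ z in Metric.closedBall (d y) (3 * ρ y), ENNReal.ofReal |f z| :=
      lintegral_mono_set (Metric.closedBall_subset_closedBall (by linarith [hρ y]))
    have e7 := (hav y).trans_le (e6.trans e5)
    refine absurd e7 (not_lt.2 ?_)
    rw [← mul_assoc, mul_comm τ]
    gcongr
    calc (ENNReal.ofReal 3) ^ n ≤ 15 ^ n := by
          gcongr
          rw [← ENNReal.ofReal_ofNat]; exact ENNReal.ofReal_le_ofReal (by norm_num)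
      _ ≤ 2 * 15 ^ n := le_mul_of_one_le_left' (by norm_num)
  have key := vitali_weak volume (fun z => ENNReal.ofReal |f z|) (univ : Set S) d ρ r
    (fun a _ => ⟨hρ a, hsmall a⟩) (2 * 3 ^ n * τ) (by
      intro y _
      refine le_trans (le_of_eq ?_) (hav y).le
      rw [vol_ball_mul _ (by norm_num) (hρ y).le]
      rw [show (15 : ℝ≥0∞) = 3 * 5 by norm_num, mul_pow, ENNReal.ofReal_ofNat]
      ring) (Metric.closedBall c (3 * r)) (by
      intro y _ z hz
      have e1 := Metric.mem_closedBall.1 hz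
      have e2 := Metric.mem_closedBall'.1 (hy y)
      have e3 := Metric.mem_closedBall.1 y.2.1
      have e4 := dist_triangle4 z (d y) y c
      have := hsmall y
      rw [Metric.mem_closedBall]
      linarith)
  have hsub : S ⊆ ⋃ a ∈ (univ : Set S), Metric.closedBall (d a) (ρ a) := by
    intro y hyS
    simp only [mem_iUnion]
    exact ⟨⟨y, hyS⟩, mem_univ _, hy ⟨y, hyS⟩⟩
  have e8 := le_of_maximalFn_le hM c (3 * r) (by positivity)
    (Metric.closedBall_subset_closedBall (by linarith) hx)
  rw [vol_ball_mul _ (by norm_num) hr.le, ENNReal.ofReal_ofNat] at e8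
  have e9 : 2 * 3 ^ n * τ * volume S ≤ τ * (3 ^ n * volume (Metric.closedBall c r)) :=
    (by gcongr : _ ≤ _).trans (key.trans e8)
  have e10 : (3 ^ n * τ) * (2 * volume S) ≤ (3 ^ n * τ) * volume (Metric.closedBall c r) := by
    calc _ = 2 * 3 ^ n * τ * volume S := by ring
      _ ≤ _ := e9
      _ = _ := by ring
  exact (ENNReal.mul_le_mul_iff_right (by simp [h0])
    (ENNReal.mul_ne_top (by simp) htop)).1 e10

/-- The dual weight. -/
def sig (n : ℕ) (p : ℝ) (w : (Fin n → ℝ) → ℝ) : Measure (Fin n → ℝ) :=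
  volume.withDensity fun x => ENNReal.ofReal (w x ^ (1 - p / (p - 1)))

lemma cube_ineq {n : ℕ} {p : ℝ} (hp : 1 < p) (w : (Fin n → ℝ) → ℝ) (c : Fin n → ℝ) {r : ℝ}
    (hr : 0 < r) {t : ℝ} (ht : 0 < t) :
    ENNReal.ofReal t * volume (Metric.closedBall c r ∩ {x | t < w x}) *
      sig n p w (Metric.closedBall c r) ^ (p - 1) ≤
      ApStarConst n p w * volume (Metric.closedBall c r) ^ p := by
  set B := Metric.closedBall c r with hB
  have hB0 := vol_ball_ne_zero c hr
  have hBt := vol_ball_ne_top c r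
  have h1 : (volume B)⁻¹ * wnormE n 1 (B.indicator fun x => ENNReal.ofReal (w x)) *
      ((volume B)⁻¹ * ∫⁻ x in B, ENNReal.ofReal (w x ^ (1 - p / (p - 1)))) ^ (p - 1) ≤
      ApStarConst n p w :=
    le_iSup₂_of_le (f := fun (Q : Set (Fin n → ℝ)) (_ : IsCube n Q) =>
      (volume Q)⁻¹ * wnormE n 1 (Q.indicator fun x => ENNReal.ofReal (w x)) *
      ((volume Q)⁻¹ * ∫⁻ x in Q, ENNReal.ofReal (w x ^ (1 - p / (p - 1)))) ^ (p - 1))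
      B (isCube_closedBall c hr) le_rfl
  have h2 : ENNReal.ofReal t * volume (B ∩ {x | t < w x}) ≤
      wnormE n 1 (B.indicator fun x => ENNReal.ofReal (w x)) := by
    refine le_iSup₂_of_le t ht ?_
    rw [div_one, ENNReal.rpow_one]
    gcongr
    rintro x ⟨hx, hx'⟩
    simp only [mem_ofPred_eq, indicator_of_mem hx]
    exact (ENNReal.ofReal_lt_ofReal_iff (ht.trans hx')).2 hx'
  have h3 : sig n p w B = ∫⁻ x in B, ENNReal.ofReal (w x ^ (1 - p / (p - 1))) :=
    withDensity_apply _ Metric.isClosed_closedBall.measurableSet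
  rw [← h3] at h1
  have hp1 : 0 ≤ p - 1 := by linarith
  have h4 : volume B ^ p = volume B * volume B ^ (p - 1) := by
    have e0 := ENNReal.rpow_add 1 (p - 1) hB0 hBt
    rw [ENNReal.rpow_one] at e0
    rw [← e0]
    congr 1
    ring
  calc _ ≤ wnormE n 1 (B.indicator fun x => ENNReal.ofReal (w x)) * sig n p w B ^ (p - 1) := by
        gcongr
    _ = ((volume B)⁻¹ * wnormE n 1 (B.indicator fun x => ENNReal.ofReal (w x)) *
      ((volume B)⁻¹ * sig n p w B) ^ (p - 1)) * volume B ^ p := by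
        have e1 : (volume B)⁻¹ * volume B = 1 := ENNReal.inv_mul_cancel hB0 hBt
        have e2 : ((volume B)⁻¹) ^ (p - 1) * volume B ^ (p - 1) = 1 := by
          rw [← ENNReal.mul_rpow_of_nonneg _ _ hp1, e1, ENNReal.one_rpow]
        rw [h4, ENNReal.mul_rpow_of_nonneg _ _ hp1]
        calc _ = 1 * 1 * (wnormE n 1 (B.indicator fun x => ENNReal.ofReal (w x)) *
              sig n p w B ^ (p - 1)) := by simp
          _ = ((volume B)⁻¹ * volume B) * (((volume B)⁻¹) ^ (p - 1) * volume B ^ (p - 1)) *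
              (wnormE n 1 (B.indicator fun x => ENNReal.ofReal (w x)) *
              sig n p w B ^ (p - 1)) := by rw [e1, e2]
          _ = _ := by ring
    _ ≤ _ := by gcongr

lemma sig_pos {n : ℕ} {p : ℝ} {w : (Fin n → ℝ) → ℝ} (hwm : Measurable w)
    (hw : ∀ᵐ x ∂(volume : Measure (Fin n → ℝ)), 0 < w x) {E : Set (Fin n → ℝ)}
    (hE : volume E ≠ 0) : sig n p w E ≠ 0 := by
  intro h
  apply hE
  have hac : (volume : Measure (Fin n → ℝ)) ≪ sig n p w := by
    refine withDensity_absolutelyContinuous' (by fun_prop) ?_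
    filter_upwards [hw] with x hx
    simp only [ne_eq, ENNReal.ofReal_eq_zero, not_le]
    positivity
  exact hac h

lemma sig_ball_ne_top {n : ℕ} {p : ℝ} (hp : 1 < p) {w : (Fin n → ℝ) → ℝ}
    (hw : ∀ᵐ x ∂(volume : Measure (Fin n → ℝ)), 0 < w x) (hA : ApStarConst n p w < ∞)
    (c : Fin n → ℝ) {r : ℝ} (hr : 0 < r) : sig n p w (Metric.closedBall c r) ≠ ∞ := by
  intro htop
  set B := Metric.closedBall c r with hB
  have hex : ∃ m : ℕ, volume (B ∩ {x | (1 : ℝ) / (m + 1) < w x}) ≠ 0 := by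
    by_contra hcon
    push Not at hcon
    have h1 : volume (⋃ m : ℕ, (B ∩ {x | (1 : ℝ) / (m + 1) < w x})) = 0 :=
      measure_iUnion_null hcon
    have h2 : volume B ≤ volume ((⋃ m : ℕ, (B ∩ {x | (1 : ℝ) / (m + 1) < w x})) ∪
        {x | ¬ 0 < w x}) := by
      refine measure_mono fun x hx => ?_
      by_cases h : 0 < w x
      · left
        obtain ⟨m, hm⟩ := exists_nat_one_div_lt h
        exact mem_iUnion.2 ⟨m, hx, hm⟩
      · exact Or.inr h
    have h3 : volume {x | ¬ 0 < w x} = 0 := ae_iff.1 hw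
    have h4 := h2.trans (measure_union_le _ _)
    rw [h1, h3, add_zero] at h4
    exact vol_ball_ne_zero c hr (le_antisymm h4 (zero_le))
  obtain ⟨m, hm⟩ := hex
  have ht : (0 : ℝ) < 1 / (m + 1) := by positivity
  have h := cube_ineq hp w c hr ht
  rw [← hB, htop, ENNReal.top_rpow_of_pos (by linarith), ENNReal.mul_top] at h
  · have : ApStarConst n p w * volume B ^ p < ∞ :=
      ENNReal.mul_lt_top hA (ENNReal.rpow_lt_top_of_nonneg (by linarith) (vol_ball_ne_top c r))
    exact absurd (this.trans_le h) (lt_irrefl _)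
  · exact mul_ne_zero (by simpa using (by positivity : (0:ℝ) < m + 1)) hm

lemma ainf {n : ℕ} {p : ℝ} (hp : 1 < p) {w : (Fin n → ℝ) → ℝ} (hwm : Measurable w)
    (hw : ∀ᵐ x ∂(volume : Measure (Fin n → ℝ)), 0 < w x) (hA : ApStarConst n p w < ∞)
    (c : Fin n → ℝ) {r : ℝ} (hr : 0 < r) {E : Set (Fin n → ℝ)} (hEm : MeasurableSet E)
    (hEB : E ⊆ Metric.closedBall c r) (κ : ℝ≥0∞) 
    (hκ : volume (Metric.closedBall c r) ≤ κ * volume E) :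
    sig n p w (Metric.closedBall c r) ^ (p - 1) ≤
      (2 * κ) ^ p * ApStarConst n p w * sig n p w E ^ (p - 1) := by
  set B := Metric.closedBall c r with hB
  have hp1 : 0 < p - 1 := by linarith
  have hp0 : 0 < p := by linarith
  have hE0 : volume E ≠ 0 := by
    intro h
    rw [h, mul_zero] at hκ
    exact vol_ball_ne_zero c hr (le_antisymm hκ zero_le)
  have hEt : volume E ≠ ∞ := ((measure_mono hEB).trans_lt (vol_ball_ne_top c r).lt_top).ne
  have hs0 : sig n p w E ≠ 0 := sig_pos hwm hw hE0
  have hst : sig n p w E ≠ ∞ :=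
    ((measure_mono hEB).trans_lt (sig_ball_ne_top hp hw hA c hr).lt_top).ne
  set v := (volume E).toReal with hv
  set e := (sig n p w E).toReal with he
  have hv0 : 0 < v := ENNReal.toReal_pos hE0 hEt
  have he0 : 0 < e := ENNReal.toReal_pos hs0 hst
  have hvE : volume E = ENNReal.ofReal v := (ENNReal.ofReal_toReal hEt).symm
  have heE : sig n p w E = ENNReal.ofReal e := (ENNReal.ofReal_toReal hst).symm
  set t := (v / (2 * e)) ^ (p - 1) with ht
  have ht0 : 0 < t := by positivity
  have hch : ENNReal.ofReal (2 * e / v) * volume (E ∩ {x | w x ≤ t}) ≤ ENNReal.ofReal e := by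
    have hm : MeasurableSet (E ∩ {x | w x ≤ t}) := hEm.inter (measurableSet_le hwm measurable_const)
    rw [← heE, sig, withDensity_apply _ hEm, ← setLIntegral_const]
    calc ∫⁻ _ in E ∩ {x | w x ≤ t}, ENNReal.ofReal (2 * e / v)
        ≤ ∫⁻ x in E ∩ {x | w x ≤ t}, ENNReal.ofReal (w x ^ (1 - p / (p - 1))) := by
          refine lintegral_mono_ae ?_
          filter_upwards [ae_restrict_of_ae hw, ae_restrict_mem hm] with x hx hx'
          refine ENNReal.ofReal_le_ofReal ?_
          have h1 : w x ≤ t := hx'.2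
          have h2 : t ^ (1 - p / (p - 1)) ≤ w x ^ (1 - p / (p - 1)) :=
            Real.rpow_le_rpow_of_nonpos hx h1 (by
              rw [sub_nonpos, le_div_iff₀ hp1]; linarith)
          refine le_trans (le_of_eq ?_) h2
          rw [ht, ← Real.rpow_mul (by positivity),
            show (p - 1) * (1 - p / (p - 1)) = -1 by field_simp; ring, Real.rpow_neg_one, inv_div]
      _ ≤ _ := lintegral_mono_set inter_subset_left
  have hhalf : volume (E ∩ {x | w x ≤ t}) ≤ ENNReal.ofReal (v / 2) := by
    calc _ = ENNReal.ofReal (v / (2 * e)) * (ENNReal.ofReal (2 * e / v) *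
        volume (E ∩ {x | w x ≤ t})) := by
          rw [← mul_assoc, ← ENNReal.ofReal_mul (by positivity),
            show v / (2 * e) * (2 * e / v) = 1 by field_simp, ENNReal.ofReal_one, one_mul]
      _ ≤ ENNReal.ofReal (v / (2 * e)) * ENNReal.ofReal e := by gcongr
      _ = _ := by
          rw [← ENNReal.ofReal_mul (by positivity)]; congr 1; field_simp
  have hbig : ENNReal.ofReal (v / 2) ≤ volume (B ∩ {x | t < w x}) := by
    have h1 : volume E ≤ volume (E ∩ {x | w x ≤ t}) + volume (B ∩ {x | t < w x}) := by
      refine (measure_mono ?_).trans (measure_union_le _ _)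
      intro x hx
      rcases le_or_gt (w x) t with h | h
      · exact Or.inl ⟨hx, h⟩
      · exact Or.inr ⟨hEB hx, h⟩
    have h2 : ENNReal.ofReal (v / 2) + ENNReal.ofReal (v / 2) ≤
        ENNReal.ofReal (v / 2) + volume (B ∩ {x | t < w x}) := by
      calc _ = volume E := by
            rw [hvE, ← ENNReal.ofReal_add (by positivity) (by positivity)]; congr 1; ring
        _ ≤ _ := h1.trans (by gcongr)
    exact (ENNReal.add_le_add_iff_left ENNReal.ofReal_ne_top).1 h2
  have hc := cube_ineq hp w c hr ht0
  rw [← hB] at hc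
  have hc2 : ENNReal.ofReal (t * (v / 2)) * sig n p w B ^ (p - 1) ≤
      ApStarConst n p w * (κ ^ p * ENNReal.ofReal (v ^ p)) := by
    calc _ ≤ ENNReal.ofReal t * volume (B ∩ {x | t < w x}) * sig n p w B ^ (p - 1) := by
          rw [ENNReal.ofReal_mul ht0.le]; gcongr
      _ ≤ _ := hc
      _ ≤ ApStarConst n p w * (κ * volume E) ^ p := by gcongr
      _ = _ := by
          rw [ENNReal.mul_rpow_of_nonneg _ _ hp0.le, hvE, ENNReal.ofReal_rpow_of_pos hv0]
  set u := (2 / v) ^ p * e ^ (p - 1) with hu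
  have hu0 : 0 < u := by positivity
  have hut : u * (t * (v / 2)) = 1 := by
    rw [hu, ht, Real.div_rpow hv0.le (by positivity), Real.mul_rpow (by norm_num) he0.le,
      Real.div_rpow (by norm_num) hv0.le, Real.rpow_sub_one hv0.ne', Real.rpow_sub_one two_ne_zero]
    have := Real.rpow_pos_of_pos hv0 p
    have := Real.rpow_pos_of_pos he0 (p - 1)
    have := Real.rpow_pos_of_pos two_pos p
    field_simp
  have huv : u * v ^ p = 2 ^ p * e ^ (p - 1) := by
    rw [hu, Real.div_rpow (by norm_num) hv0.le]
    have := Real.rpow_pos_of_pos hv0 p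
    field_simp
  calc sig n p w B ^ (p - 1) = ENNReal.ofReal u * (ENNReal.ofReal (t * (v / 2)) *
        sig n p w B ^ (p - 1)) := by
        rw [← mul_assoc, ← ENNReal.ofReal_mul hu0.le, hut, ENNReal.ofReal_one, one_mul]
    _ ≤ ENNReal.ofReal u * (ApStarConst n p w * (κ ^ p * ENNReal.ofReal (v ^ p))) := by gcongr
    _ = ApStarConst n p w * κ ^ p * (ENNReal.ofReal (u * v ^ p)) := by
        rw [ENNReal.ofReal_mul hu0.le]; ring
    _ = _ := by
        rw [huv, heE, ENNReal.mul_rpow_of_nonneg _ _ hp0.le, ENNReal.ofReal_mul (by positivity),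
          ← ENNReal.ofReal_rpow_of_pos he0, ← ENNReal.ofReal_rpow_of_pos two_pos,
          ENNReal.ofReal_ofNat]
        ring

lemma level_family {n : ℕ} (f : (Fin n → ℝ) → ℝ)
    (hfi : ∫⁻ y, ENNReal.ofReal |f y| < ∞) (τ : ℝ≥0∞) (h0 : τ ≠ 0) (htop : τ ≠ ∞)
    (D : Set (Fin n → ℝ)) (hD : ∀ x ∈ D, τ < maximalFn n f x ∧
      maximalFn n f x ≤ 2 * 15 ^ n * τ) (hn : 1 ≤ n) :
    ∃ (u : Set (Fin n → ℝ)) (c : (Fin n → ℝ) → (Fin n → ℝ)) (r : (Fin n → ℝ) → ℝ)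
      (E : (Fin n → ℝ) → Set (Fin n → ℝ)),
      u.Countable ∧ u.PairwiseDisjoint E ∧ (D ⊆ ⋃ x ∈ u, Metric.closedBall (c x) (5 * r x)) ∧
      ∀ x ∈ u, 0 < r x ∧
        τ * volume (Metric.closedBall (c x) (r x)) ≤
          ∫⁻ y in Metric.closedBall (c x) (r x), ENNReal.ofReal |f y| ∧
        MeasurableSet (E x) ∧ E x ⊆ Metric.closedBall (c x) (r x) ∧
        volume (Metric.closedBall (c x) (5 * r x)) ≤ 2 * 5 ^ n * volume (E x) ∧
        ∀ y ∈ E x, τ < maximalFn n f y ∧ maximalFn n f y ≤ 2 * 15 ^ n * (2 * 15 ^ n * τ) := by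
  classical
  have h1 : ∀ x : Fin n → ℝ, ∃ (c : Fin n → ℝ) (r : ℝ), x ∈ D → (0 < r ∧ x ∈ Metric.closedBall c r ∧
      τ * volume (Metric.closedBall c r) <
        ∫⁻ z in Metric.closedBall c r, ENNReal.ofReal |f z|) := by
    intro x
    by_cases hx : x ∈ D
    · obtain ⟨c, r, h⟩ := lt_maximalFn.1 (hD x hx).1
      exact ⟨c, r, fun _ => h⟩
    · exact ⟨0, 0, fun h => absurd h hx⟩
  choose c r hcr using h1
  set L := (∫⁻ y, ENNReal.ofReal |f y|) / τ with hL
  have hLt : L ≠ ∞ := ENNReal.div_ne_top hfi.ne h0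
  have hR : ∀ x ∈ D, r x ≤ max 1 L.toReal := by
    intro x hx
    obtain ⟨hr, -, hav⟩ := hcr x hx
    by_contra hcon
    push Not at hcon
    rw [max_lt_iff] at hcon
    have e1 : volume (Metric.closedBall (c x) (r x)) ≤ L := by
      rw [hL, ENNReal.le_div_iff_mul_le (Or.inl h0) (Or.inl htop), mul_comm]
      exact hav.le.trans (setLIntegral_le_lintegral _ _)
    rw [Real.volume_pi_closedBall _ hr.le, Fintype.card_fin] at e1
    have e2 := (ENNReal.ofReal_le_iff_le_toReal hLt).1 e1
    have e3 : r x ≤ (2 * r x) ^ n := by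
      calc r x ≤ 2 * r x := by linarith
        _ ≤ _ := le_self_pow₀ (by linarith) (by omega)
    linarith
  obtain ⟨u, huD, hdisj, hcov⟩ := Vitali.exists_disjoint_subfamily_covering_enlargement_closedBall
    D c r _ hR 5 (by norm_num)
  have hc : u.Countable := hdisj.countable_of_nonempty_interior fun a ha =>
    (Metric.nonempty_ball.2 (hcr a (huD ha)).1).mono Metric.ball_subset_interior_closedBall
  let S : (Fin n → ℝ) → Set (Fin n → ℝ) := fun x => Metric.closedBall (c x) (r x) ∩
    {y | 2 * 15 ^ n * (2 * 15 ^ n * τ) < maximalFn n f y}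
  let E : (Fin n → ℝ) → Set (Fin n → ℝ) := fun x =>
    Metric.closedBall (c x) (r x) \ toMeasurable volume (S x)
  refine ⟨u, c, r, E, hc, hdisj.mono fun x => sdiff_subset, ?_, ?_⟩
  · intro x hx
    obtain ⟨b, hb, hab⟩ := hcov x hx
    exact mem_biUnion hb (hab (hcr x hx).2.1)
  intro x hx
  obtain ⟨hr, hxb, hav⟩ := hcr x (huD hx)
  have hS := local_weak f (c x) (r x) hr x hxb (2 * 15 ^ n * τ) (by simp [h0])
    (ENNReal.mul_ne_top (ENNReal.mul_ne_top (by simp) (by simp)) htop) (hD x (huD hx)).2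
  refine ⟨hr, hav.le, Metric.isClosed_closedBall.measurableSet.diff (measurableSet_toMeasurable _ _),
    sdiff_subset, ?_, ?_⟩
  · rw [vol_ball_mul _ (by norm_num) hr.le, ENNReal.ofReal_ofNat]
    set B := Metric.closedBall (c x) (r x) with hB
    have hBt : volume B ≠ ∞ := vol_ball_ne_top _ _
    have e1 : volume B ≤ volume (E x) + volume (S x) := by
      calc volume B ≤ volume (E x ∪ toMeasurable volume (S x)) := by
            refine measure_mono fun y hy => ?_
            by_cases h : y ∈ toMeasurable volume (S x)
            · exact Or.inr h
            · exact Or.inl ⟨hy, h⟩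
        _ ≤ _ := (measure_union_le _ _).trans (by rw [measure_toMeasurable])
    have e2 : volume B + volume B ≤ volume B + 2 * volume (E x) := by
      calc volume B + volume B = 2 * volume B := by ring
        _ ≤ 2 * (volume (E x) + volume (S x)) := by gcongr
        _ = 2 * volume (S x) + 2 * volume (E x) := by ring
        _ ≤ _ := by gcongr
    have e3 := (ENNReal.add_le_add_iff_left hBt).1 e2
    calc 5 ^ n * volume B ≤ 5 ^ n * (2 * volume (E x)) := by gcongr
      _ = _ := by ring
  · intro y hy
    refine ⟨lt_maximalFn.2 ⟨c x, r x, hr, hy.1, hav⟩, ?_⟩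
    by_contra hcon
    exact hy.2 (subset_toMeasurable _ _ ⟨hy.1, not_le.1 hcon⟩)

lemma single_cube {n : ℕ} {p : ℝ} (hp : 1 < p) {w : (Fin n → ℝ) → ℝ} (hwm : Measurable w)
    (hw0 : ∀ x, 0 ≤ w x)
    (hw : ∀ᵐ x ∂(volume : Measure (Fin n → ℝ)), 0 < w x) (hA : ApStarConst n p w < ∞)
    (c : Fin n → ℝ) {r : ℝ} (hr : 0 < r) {E : Set (Fin n → ℝ)} (hEm : MeasurableSet E)
    (hEB : E ⊆ Metric.closedBall c r)
    (hκ : volume (Metric.closedBall c (5 * r)) ≤ 2 * 5 ^ n * volume E)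
    (τ b Γ : ℝ≥0∞) (h0 : τ ≠ 0) (htop : τ ≠ ∞) (hb0 : b ≠ 0) (hbt : b ≠ ∞)
    (hΓ : τ * volume (Metric.closedBall c r) ≤ Γ) {t : ℝ} (ht : 0 < t) :
    ENNReal.ofReal t ^ p * volume (Metric.closedBall c (5 * r) ∩
        {x | ENNReal.ofReal t < ENNReal.ofReal (w x ^ (1 / p)) * (b * τ)}) ≤
      (5 ^ n * b) ^ p * ((2 * (2 * 5 ^ n)) ^ p) ^ (1 / (p - 1)) *
        ApStarConst n p w ^ (p / (p - 1)) *
        (sig n p w E * (Γ / sig n p w (Metric.closedBall c (5 * r))) ^ p) := by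
  have hp1 : 0 < p - 1 := by linarith
  have hp0 : 0 < p := by linarith
  have hr5 : 0 < 5 * r := by positivity
  set B := Metric.closedBall c (5 * r) with hB
  set W := ApStarConst n p w with hW
  set s := sig n p w B with hs
  have hs0 : s ≠ 0 := sig_pos hwm hw (vol_ball_ne_zero c hr5)
  have hst : s ≠ ∞ := sig_ball_ne_top hp hw hA c hr5
  have hbτ0 : b * τ ≠ 0 := mul_ne_zero hb0 h0
  have hbτt : b * τ ≠ ∞ := ENNReal.mul_ne_top hbt htop
  set β := (b * τ).toReal with hβ
  have hβ0 : 0 < β := ENNReal.toReal_pos hbτ0 hbτt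
  have hβE : b * τ = ENNReal.ofReal β := (ENNReal.ofReal_toReal hbτt).symm
  have hq : 0 < (t / β) ^ p := by positivity
  have hc := cube_ineq hp w c hr5 hq
  have hsub : {x | ENNReal.ofReal t < ENNReal.ofReal (w x ^ (1 / p)) * (b * τ)} ⊆
      {x | (t / β) ^ p < w x} := by
    intro x hx
    have hx : ENNReal.ofReal t < ENNReal.ofReal (w x ^ (1 / p)) * (b * τ) := hx
    have hwp : 0 ≤ w x ^ (1 / p) := Real.rpow_nonneg (hw0 x) _
    rw [hβE, ← ENNReal.ofReal_mul hwp] at hx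
    have h1 := (ENNReal.ofReal_lt_ofReal_iff_of_nonneg ht.le).1 hx
    have h2 : t / β < w x ^ (1 / p) := (div_lt_iff₀ hβ0).2 h1
    have h3 := Real.rpow_lt_rpow (by positivity) h2 hp0
    rw [← Real.rpow_mul (hw0 x), one_div_mul_cancel hp0.ne', Real.rpow_one] at h3
    exact h3
  have hain := ainf hp hwm hw hA c hr5 hEm
    (hEB.trans (Metric.closedBall_subset_closedBall (by linarith))) _ hκ
  rw [← hB, ← hs, ← hW] at hain
  have hain2 : s ≤ ((2 * (2 * 5 ^ n)) ^ p) ^ (1 / (p - 1)) * W ^ (1 / (p - 1)) * sig n p w E := by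
    have h1 := ENNReal.rpow_le_rpow hain (show 0 ≤ 1 / (p - 1) by positivity)
    rw [ENNReal.mul_rpow_of_nonneg _ _ (by positivity), ENNReal.mul_rpow_of_nonneg _ _ (by positivity),
      ← ENNReal.rpow_mul, ← ENNReal.rpow_mul (sig n p w E), mul_one_div_cancel hp1.ne',
      ENNReal.rpow_one, ENNReal.rpow_one] at h1
    exact h1
  set m := volume (B ∩ {x | ENNReal.ofReal t < ENNReal.ofReal (w x ^ (1 / p)) * (b * τ)}) with hm
  have hT : ENNReal.ofReal t ^ p = (b * τ) ^ p * ENNReal.ofReal ((t / β) ^ p) := by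
    rw [hβE, ENNReal.ofReal_rpow_of_pos ht, ENNReal.ofReal_rpow_of_pos hβ0,
      ← ENNReal.ofReal_mul (by positivity), ← Real.mul_rpow hβ0.le (by positivity)]
    congr 2
    field_simp
  have h5 : volume B = 5 ^ n * volume (Metric.closedBall c r) := by
    rw [hB, vol_ball_mul _ (by norm_num) hr.le, ENNReal.ofReal_ofNat]
  have hmain : ENNReal.ofReal t ^ p * m * s ^ (p - 1) ≤ (5 ^ n * b) ^ p * W * Γ ^ p := by
    calc ENNReal.ofReal t ^ p * m * s ^ (p - 1)
        = (b * τ) ^ p * (ENNReal.ofReal ((t / β) ^ p) * m * s ^ (p - 1)) := by rw [hT]; ring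
      _ ≤ (b * τ) ^ p * (ENNReal.ofReal ((t / β) ^ p) * volume (B ∩ {x | (t / β) ^ p < w x}) *
          s ^ (p - 1)) := by
          gcongr
          exact measure_mono (inter_subset_inter_right _ hsub)
      _ ≤ (b * τ) ^ p * (W * volume B ^ p) := by gcongr
      _ = (5 ^ n * b) ^ p * W * (τ * volume (Metric.closedBall c r)) ^ p := by
          rw [h5]
          simp only [ENNReal.mul_rpow_of_nonneg _ _ hp0.le]
          ring
      _ ≤ _ := by gcongr
  have hsp : s ^ (p - 1) * s ^ (1 - p) = 1 := by
    rw [← ENNReal.rpow_add _ _ hs0 hst]; simp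
  have hΓs : Γ ^ p * s ^ (1 - p) = s * (Γ / s) ^ p := by
    rw [ENNReal.div_rpow_of_nonneg _ _ hp0.le, div_eq_mul_inv, ← ENNReal.rpow_neg,
      show 1 - p = 1 + (-p) by ring, ENNReal.rpow_add _ _ hs0 hst, ENNReal.rpow_one]
    ring
  have hWp : W ^ (p / (p - 1)) = W * W ^ (1 / (p - 1)) := by
    have := ENNReal.rpow_add_of_nonneg (x := W) 1 (1 / (p - 1)) zero_le_one (by positivity)
    rw [ENNReal.rpow_one] at this
    rw [← this]
    congr 1
    field_simp
    ring
  calc ENNReal.ofReal t ^ p * m = ENNReal.ofReal t ^ p * m * s ^ (p - 1) * s ^ (1 - p) := by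
        rw [mul_assoc _ (s ^ (p - 1)), hsp, mul_one]
    _ ≤ (5 ^ n * b) ^ p * W * Γ ^ p * s ^ (1 - p) := by gcongr
    _ = (5 ^ n * b) ^ p * W * (s * (Γ / s) ^ p) := by rw [mul_assoc _ (Γ ^ p), hΓs]
    _ ≤ (5 ^ n * b) ^ p * W * ((((2 * (2 * 5 ^ n)) ^ p) ^ (1 / (p - 1)) * W ^ (1 / (p - 1)) *
          sig n p w E) * (Γ / s) ^ p) := by gcongr
    _ = _ := by rw [hWp]; ring

lemma lint_dual {n : ℕ} {p : ℝ} {w : (Fin n → ℝ) → ℝ} (hwm : Measurable w)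
    (hw : ∀ᵐ x ∂(volume : Measure (Fin n → ℝ)), 0 < w x)
    {f : (Fin n → ℝ) → ℝ} (hf : Measurable f) {s : Set (Fin n → ℝ)} (hs : MeasurableSet s) :
    ∫⁻ y in s, ENNReal.ofReal (|f y| * w y ^ (p / (p - 1) - 1)) ∂(sig n p w) =
      ∫⁻ y in s, ENNReal.ofReal |f y| := by
  rw [sig, setLIntegral_withDensity_eq_setLIntegral_mul _ (by fun_prop)
    (by have : Measurable fun y => |f y| := hf.abs
        fun_prop) hs]
  refine lintegral_congr_ae (ae_restrict_of_ae ?_)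
  filter_upwards [hw] with x hx
  rw [Pi.mul_apply, ← ENNReal.ofReal_mul (by positivity)]
  congr 1
  rw [mul_left_comm, ← Real.rpow_add hx]
  simp

lemma lint_dual_p {n : ℕ} {p : ℝ} (hp : 1 < p) {w : (Fin n → ℝ) → ℝ} (hwm : Measurable w)
    (hw : ∀ᵐ x ∂(volume : Measure (Fin n → ℝ)), 0 < w x)
    {f : (Fin n → ℝ) → ℝ} (hf : Measurable f) :
    ∫⁻ y, ENNReal.ofReal ((|f y| * w y ^ (p / (p - 1) - 1)) ^ p) ∂(sig n p w) =
      ∫⁻ y, ENNReal.ofReal (|f y| ^ p * w y) := by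
  have hp1 : p - 1 ≠ 0 := by linarith
  rw [sig, lintegral_withDensity_eq_lintegral_mul _ (by fun_prop)
    (by have : Measurable fun y => |f y| := hf.abs
        fun_prop)]
  refine lintegral_congr_ae ?_
  filter_upwards [hw] with x hx
  rw [Pi.mul_apply, ← ENNReal.ofReal_mul (by positivity)]
  congr 1
  rw [Real.mul_rpow (abs_nonneg _) (by positivity), mul_left_comm, ← Real.rpow_mul hx.le,
    ← Real.rpow_add hx]
  rw [show 1 - p / (p - 1) + (p / (p - 1) - 1) * p = 1 by field_simp; ring, Real.rpow_one]

/-- The multiplicative constant in the distributional estimate. -/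
def bigK (n : ℕ) (p : ℝ) : ℝ≥0∞ :=
  (5 ^ n * (2 * 15 ^ n)) ^ p * ((2 * (2 * 5 ^ n)) ^ p) ^ (1 / (p - 1)) *
    ENNReal.ofReal (p / (p - 1) * 2 ^ p)

lemma half_bound {n : ℕ} (hn : 1 ≤ n) {p : ℝ} (hp : 1 < p) {w : (Fin n → ℝ) → ℝ}
    (hwm : Measurable w) (hw0 : ∀ x, 0 ≤ w x)
    (hw : ∀ᵐ x ∂(volume : Measure (Fin n → ℝ)), 0 < w x) (hA : ApStarConst n p w < ∞)
    {f : (Fin n → ℝ) → ℝ} (hf : Measurable f) (hfi : ∫⁻ y, ENNReal.ofReal |f y| < ∞)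
    {t : ℝ} (ht : 0 < t) (i : ℤ) :
    ENNReal.ofReal t ^ p * volume {x | ∃ m : ℤ, (2 * 15 ^ n : ℝ≥0∞) ^ (2 * m + i) < maximalFn n f x ∧
      maximalFn n f x ≤ 2 * 15 ^ n * (2 * 15 ^ n) ^ (2 * m + i) ∧
      ENNReal.ofReal t < ENNReal.ofReal (w x ^ (1 / p)) * maximalFn n f x} ≤
      bigK n p * ApStarConst n p w ^ (p / (p - 1)) *
        ∫⁻ x, ENNReal.ofReal (|f x| ^ p * w x) := by
  have hp0 : 0 < p := by linarith
  set b : ℝ≥0∞ := 2 * 15 ^ n with hb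
  have hb0 : b ≠ 0 := by simp [hb]
  have hbt : b ≠ ∞ := ENNReal.mul_ne_top (by simp) (by simp)
  have hb1 : 1 ≤ b := by
    rw [hb]; exact one_le_mul (by norm_num) (one_le_pow₀ (by norm_num))
  set τ : ℤ → ℝ≥0∞ := fun m => b ^ (2 * m + i) with hτ
  have hτ0 : ∀ m, τ m ≠ 0 := fun m => (ENNReal.zpow_pos hb0 hbt _).ne'
  have hτt : ∀ m, τ m ≠ ∞ := fun m => ENNReal.zpow_ne_top hb0 hbt _
  have hτs : ∀ m m', m < m' → b * (b * τ m) ≤ τ m' := by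
    intro m m' hmm
    have : b * (b * τ m) = b ^ (2 * (m + 1) + i) := by
      rw [show 2 * (m + 1) + i = 1 + (1 + (2 * m + i)) by ring, ENNReal.zpow_add hb0 hbt,
        ENNReal.zpow_add hb0 hbt, zpow_one]
    rw [this]
    exact ENNReal.zpow_le_of_le hb1 (by omega)
  let D : ℤ → Set (Fin n → ℝ) := fun m => {x | τ m < maximalFn n f x ∧
      maximalFn n f x ≤ b * τ m ∧
      ENNReal.ofReal t < ENNReal.ofReal (w x ^ (1 / p)) * maximalFn n f x}
  have hlev := fun m => level_family f hfi (τ m) (hτ0 m) (hτt m) (D m)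
    (fun x hx => ⟨hx.1, hx.2.1⟩) hn
  choose u c r E hu hdis hcov hprop using hlev
  let J := Σ m : ℤ, u m
  have : ∀ m, Countable (u m) := fun m => (hu m).to_subtype
  let cj : J → (Fin n → ℝ) := fun j => c j.1 j.2
  let rj : J → ℝ := fun j => r j.1 j.2
  let Ej : J → Set (Fin n → ℝ) := fun j => E j.1 j.2
  have hJ : ∀ j : J, 0 < rj j ∧
        τ j.1 * volume (Metric.closedBall (cj j) (rj j)) ≤
          ∫⁻ y in Metric.closedBall (cj j) (rj j), ENNReal.ofReal |f y| ∧
        MeasurableSet (Ej j) ∧ Ej j ⊆ Metric.closedBall (cj j) (rj j) ∧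
        volume (Metric.closedBall (cj j) (5 * rj j)) ≤ 2 * 5 ^ n * volume (Ej j) ∧
        ∀ y ∈ Ej j, τ j.1 < maximalFn n f y ∧ maximalFn n f y ≤ b * (b * τ j.1) :=
    fun j => hprop j.1 j.2 j.2.2
  have hdj : Pairwise (Function.onFun Disjoint Ej) := by
    have hlt : ∀ j k : J, j.1 < k.1 → Disjoint (Ej j) (Ej k) := by
      intro j k hjk
      rw [Set.disjoint_left]
      intro y hy hy'
      have h1 := ((hJ j).2.2.2.2.2 y hy).2
      have h2 := ((hJ k).2.2.2.2.2 y hy').1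
      exact absurd (h2.trans_le (h1.trans (hτs _ _ hjk))) (lt_irrefl _)
    intro j k hjk
    rcases lt_trichotomy j.1 k.1 with h | h | h
    · exact hlt j k h
    · obtain ⟨m, x⟩ := j
      obtain ⟨m', x'⟩ := k
      simp only at h
      subst h
      refine hdis m x.2 x'.2 fun hxx => hjk ?_
      rw [Subtype.ext hxx]
    · exact (hlt k j h).symm
  let Γ : J → ℝ≥0∞ := fun j => ∫⁻ y in Metric.closedBall (cj j) (rj j), ENNReal.ofReal |f y|
  let s : J → ℝ≥0∞ := fun j => sig n p w (Metric.closedBall (cj j) (5 * rj j))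
  have hs0 : ∀ j, s j ≠ 0 := fun j => sig_pos hwm hw
    (vol_ball_ne_zero _ (by have := (hJ j).1; positivity))
  have hst : ∀ j, s j ≠ ∞ := fun j => sig_ball_ne_top hp hw hA _ (by have := (hJ j).1; positivity)
  have hΓt : ∀ j, Γ j ≠ ∞ := fun j => ((setLIntegral_le_lintegral _ _).trans_lt hfi).ne
  let a : J → ℝ := fun j => (Γ j / s j).toReal
  have haE : ∀ j, ENNReal.ofReal (a j) = Γ j / s j := fun j =>
    ENNReal.ofReal_toReal (ENNReal.div_ne_top (hΓt j) (hs0 j))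
  have ha0 : ∀ j, 0 ≤ a j := fun j => ENNReal.toReal_nonneg
  have : SFinite (sig n p w) := by unfold sig; infer_instance
  have hcar : ∑' j : J, sig n p w (Ej j) * (Γ j / s j) ^ p ≤
      ENNReal.ofReal (p / (p - 1) * 2 ^ p) * ∫⁻ x, ENNReal.ofReal (|f x| ^ p * w x) := by
    rw [ENNReal.tsum_eq_iSup_sum]
    refine iSup_le fun F => ?_
    have := carleson_fin p hp (sig n p w) (fun y => |f y| * w y ^ (p / (p - 1) - 1))
      (by have : Measurable fun y => |f y| := hf.abs
          fun_prop) (fun x => mul_nonneg (abs_nonneg _) (Real.rpow_nonneg (hw0 x) _))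
      F cj rj (fun j _ => (hJ j).1) Ej (fun j => (hJ j).2.2.1) (fun j => (hJ j).2.2.2.1)
      (fun j _ k _ hjk => hdj hjk) a ha0 hst (by
        intro j _
        rw [lint_dual hwm hw hf Metric.isClosed_closedBall.measurableSet, haE j]
        exact (ENNReal.div_mul_cancel (hs0 j) (hst j)).le)
    rw [lint_dual_p hp hwm hw hf] at this
    refine le_trans (le_of_eq (Finset.sum_congr rfl fun j _ => ?_)) this
    rw [← ENNReal.ofReal_rpow_of_nonneg (ha0 j) hp0.le, haE]
  let G : J → Set (Fin n → ℝ) := fun j => Metric.closedBall (cj j) (5 * rj j) ∩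
        {x | ENNReal.ofReal t < ENNReal.ofReal (w x ^ (1 / p)) * (b * τ j.1)}
  have hsub : {x | ∃ m : ℤ, b ^ (2 * m + i) < maximalFn n f x ∧
      maximalFn n f x ≤ b * b ^ (2 * m + i) ∧
      ENNReal.ofReal t < ENNReal.ofReal (w x ^ (1 / p)) * maximalFn n f x} ⊆ ⋃ j, G j := by
    rintro x ⟨m, h1, h2, h3⟩
    have hx : x ∈ D m := ⟨h1, h2, h3⟩
    obtain ⟨z, hz, hxz⟩ := mem_iUnion₂.1 (hcov m hx)
    refine mem_iUnion.2 ⟨⟨m, ⟨z, hz⟩⟩, hxz, ?_⟩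
    exact h3.trans_le (by gcongr)
  set K := (5 ^ n * b) ^ p * ((2 * (2 * 5 ^ n)) ^ p) ^ (1 / (p - 1)) with hK
  calc _ ≤ ENNReal.ofReal t ^ p * ∑' j, volume (G j) := by
        gcongr
        exact (measure_mono hsub).trans (measure_iUnion_le _)
    _ = ∑' j, ENNReal.ofReal t ^ p * volume (G j) := ENNReal.tsum_mul_left.symm
    _ ≤ ∑' j, K * ApStarConst n p w ^ (p / (p - 1)) * (sig n p w (Ej j) * (Γ j / s j) ^ p) := by
        refine ENNReal.tsum_le_tsum fun j => ?_
        obtain ⟨h1, h2, h3, h4, h5, -⟩ := hJ j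
        exact single_cube hp hwm hw0 hw hA (cj j) h1 h3 h4 h5 (τ j.1) b (Γ j) (hτ0 _) (hτt _)
          hb0 hbt h2 ht
    _ = K * ApStarConst n p w ^ (p / (p - 1)) * ∑' j, (sig n p w (Ej j) * (Γ j / s j) ^ p) :=
        ENNReal.tsum_mul_left
    _ ≤ K * ApStarConst n p w ^ (p / (p - 1)) * (ENNReal.ofReal (p / (p - 1) * 2 ^ p) *
        ∫⁻ x, ENNReal.ofReal (|f x| ^ p * w x)) := by gcongr
    _ = _ := by rw [bigK, ← hb, ← hK]; ring

lemma bounded_case {n : ℕ} (hn : 1 ≤ n) {p : ℝ} (hp : 1 < p) {w : (Fin n → ℝ) → ℝ}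
    (hwm : Measurable w) (hw0 : ∀ x, 0 ≤ w x)
    (hw : ∀ᵐ x ∂(volume : Measure (Fin n → ℝ)), 0 < w x) (hA : ApStarConst n p w < ∞)
    {f : (Fin n → ℝ) → ℝ} (hf : Measurable f) (hfi : ∫⁻ y, ENNReal.ofReal |f y| < ∞)
    (hMf : ∀ x, maximalFn n f x ≠ ∞)
    {t : ℝ} (ht : 0 < t) :
    ENNReal.ofReal t ^ p * volume {x |
      ENNReal.ofReal t < ENNReal.ofReal (w x ^ (1 / p)) * maximalFn n f x} ≤
      2 * bigK n p * ApStarConst n p w ^ (p / (p - 1)) *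
        ∫⁻ x, ENNReal.ofReal (|f x| ^ p * w x) := by
  have hb0 : (2 * 15 ^ n : ℝ≥0∞) ≠ 0 := by simp
  have hbt : (2 * 15 ^ n : ℝ≥0∞) ≠ ∞ := ENNReal.mul_ne_top (by simp) (by simp)
  have hb1 : (1 : ℝ≥0∞) < 2 * 15 ^ n := by
    calc (1 : ℝ≥0∞) < 2 := by norm_num
      _ ≤ 2 * 15 ^ n := le_mul_of_one_le_right' (one_le_pow₀ (by norm_num))
  have h0 := half_bound hn hp hwm hw0 hw hA hf hfi ht 0
  have h1 := half_bound hn hp hwm hw0 hw hA hf hfi ht 1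
  let D : ℤ → Set (Fin n → ℝ) := fun i => {x | ∃ m : ℤ,
    (2 * 15 ^ n : ℝ≥0∞) ^ (2 * m + i) < maximalFn n f x ∧
    maximalFn n f x ≤ 2 * 15 ^ n * (2 * 15 ^ n) ^ (2 * m + i) ∧
    ENNReal.ofReal t < ENNReal.ofReal (w x ^ (1 / p)) * maximalFn n f x}
  have hsub : {x | ENNReal.ofReal t < ENNReal.ofReal (w x ^ (1 / p)) * maximalFn n f x} ⊆
      D 0 ∪ D 1 := by
    intro x hx
    have hx : ENNReal.ofReal t < ENNReal.ofReal (w x ^ (1 / p)) * maximalFn n f x := hx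
    have hM0 : maximalFn n f x ≠ 0 := by
      intro h
      rw [h, mul_zero] at hx
      exact not_lt_zero hx
    obtain ⟨k, hk1, hk2⟩ := ENNReal.exists_mem_Ioc_zpow hM0 (hMf x) hb1 hbt
    rw [add_comm, ENNReal.zpow_add hb0 hbt, zpow_one] at hk2
    rcases Int.even_or_odd' k with ⟨m, hm | hm⟩
    · refine Or.inl ⟨m, ?_⟩
      rw [add_zero, ← hm]
      exact ⟨hk1, hk2, hx⟩
    · refine Or.inr ⟨m, ?_⟩
      rw [← hm]
      exact ⟨hk1, hk2, hx⟩
  calc _ ≤ ENNReal.ofReal t ^ p * (volume (D 0) + volume (D 1)) := by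
        gcongr
        exact (measure_mono hsub).trans (measure_union_le _ _)
    _ ≤ _ := by
        rw [mul_add]
        exact (add_le_add h0 h1).trans (le_of_eq (by ring))

def truncSet (n N : ℕ) (f : (Fin n → ℝ) → ℝ) : Set (Fin n → ℝ) :=
  Metric.closedBall 0 N ∩ {x | |f x| ≤ N}

lemma truncSet_mono (n : ℕ) (f : (Fin n → ℝ) → ℝ) : Monotone fun N => truncSet n N f := by
  intro a b hab x hx
  have h : (a : ℝ) ≤ b := by exact_mod_cast hab
  exact ⟨Metric.closedBall_subset_closedBall h hx.1, le_trans hx.2 h⟩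

lemma truncSet_meas (n N : ℕ) {f : (Fin n → ℝ) → ℝ} (hf : Measurable f) :
    MeasurableSet (truncSet n N f) :=
  Metric.isClosed_closedBall.measurableSet.inter
    (measurableSet_le (by fun_prop) measurable_const)

lemma trunc_abs (n N : ℕ) (f : (Fin n → ℝ) → ℝ) (x : Fin n → ℝ) :
    ENNReal.ofReal |(truncSet n N f).indicator f x| =
      (truncSet n N f).indicator (fun y => ENNReal.ofReal |f y|) x := by
  by_cases h : x ∈ truncSet n N f <;> simp [h]

lemma trunc_abs_le (n N : ℕ) (f : (Fin n → ℝ) → ℝ) (x : Fin n → ℝ) :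
    |(truncSet n N f).indicator f x| ≤ N := by
  by_cases h : x ∈ truncSet n N f
  · simpa [h] using h.2
  · simp [h]

lemma trunc_abs_le_self (n N : ℕ) (f : (Fin n → ℝ) → ℝ) (x : Fin n → ℝ) :
    |(truncSet n N f).indicator f x| ≤ |f x| := by
  by_cases h : x ∈ truncSet n N f <;> simp [h]

lemma maximalFn_trunc_le {n : ℕ} (N : ℕ) (f : (Fin n → ℝ) → ℝ) (x : Fin n → ℝ) :
    maximalFn n ((truncSet n N f).indicator f) x ≤ N := by
  by_contra h
  obtain ⟨c, r, hr, hx, h⟩ := lt_maximalFn.1 (not_le.1 h)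
  refine absurd h (not_lt.2 ?_)
  calc _ ≤ ∫⁻ y in Metric.closedBall c r, (N : ℝ≥0∞) := by
        refine lintegral_mono fun y => ?_
        calc _ ≤ ENNReal.ofReal (N : ℝ) := ENNReal.ofReal_le_ofReal (trunc_abs_le n N f y)
          _ = N := by simp
    _ = _ := by rw [setLIntegral_const]

lemma maximalFn_mono {n : ℕ} {f g : (Fin n → ℝ) → ℝ} (h : ∀ x, |f x| ≤ |g x|) (x : Fin n → ℝ) :
    maximalFn n f x ≤ maximalFn n g x := by
  unfold maximalFn
  refine iSup_mono fun Q => iSup_mono fun _ => iSup_mono fun _ => ?_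
  exact mul_le_mul_right (lintegral_mono fun y => ENNReal.ofReal_le_ofReal (h y)) _

lemma trunc_mono (n : ℕ) (f : (Fin n → ℝ) → ℝ) {a b : ℕ} (hab : a ≤ b) (x : Fin n → ℝ) :
    |(truncSet n a f).indicator f x| ≤ |(truncSet n b f).indicator f x| := by
  by_cases h : x ∈ truncSet n a f
  · have h2 : x ∈ truncSet n b f := truncSet_mono n f hab h
    simp [h, h2]
  · simp [h]

lemma exists_mem_truncSet (n : ℕ) (f : (Fin n → ℝ) → ℝ) (x : Fin n → ℝ) :
    ∃ N, x ∈ truncSet n N f := by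
  obtain ⟨N, hN⟩ := exists_nat_ge (max (dist x 0) |f x|)
  exact ⟨N, (le_max_left _ _).trans hN, (le_max_right _ _).trans hN⟩

lemma maximalFn_le_iSup {n : ℕ} {f : (Fin n → ℝ) → ℝ} (hf : Measurable f) (x : Fin n → ℝ) :
    maximalFn n f x ≤ ⨆ N, maximalFn n ((truncSet n N f).indicator f) x := by
  refine le_of_forall_lt fun τ hτ => ?_
  obtain ⟨c, r, hr, hx, h⟩ := lt_maximalFn.1 hτ
  have e : ∫⁻ y in Metric.closedBall c r, ENNReal.ofReal |f y| =
      ⨆ N : ℕ, ∫⁻ y in Metric.closedBall c r,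
        ENNReal.ofReal |(truncSet n N f).indicator f y| := by
    rw [← lintegral_iSup]
    · refine lintegral_congr fun y => le_antisymm ?_ ?_
      · obtain ⟨N, hN⟩ := exists_mem_truncSet n f y
        refine le_trans (le_of_eq ?_)
          (le_iSup (fun N => ENNReal.ofReal |(truncSet n N f).indicator f y|) N)
        simp [hN]
      · exact iSup_le fun N => ENNReal.ofReal_le_ofReal (trunc_abs_le_self n N f y)
    · intro N
      have := hf.indicator (truncSet_meas n N hf)
      exact (continuous_abs.measurable.comp this).ennreal_ofReal
    · intro a b hab y
      exact ENNReal.ofReal_le_ofReal (trunc_mono n f hab y)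
  rw [e, lt_iSup_iff] at h
  obtain ⟨N, hN⟩ := h
  exact lt_iSup_iff.2 ⟨N, lt_maximalFn.2 ⟨c, r, hr, hx, hN⟩⟩

lemma general_case {n : ℕ} (hn : 1 ≤ n) {p : ℝ} (hp : 1 < p) {w : (Fin n → ℝ) → ℝ}
    (hwm : Measurable w) (hw0 : ∀ x, 0 ≤ w x)
    (hw : ∀ᵐ x ∂(volume : Measure (Fin n → ℝ)), 0 < w x) (hA : ApStarConst n p w < ∞)
    {f : (Fin n → ℝ) → ℝ} (hf : Measurable f)
    {t : ℝ} (ht : 0 < t) :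
    ENNReal.ofReal t ^ p * volume {x |
      ENNReal.ofReal t < ENNReal.ofReal (w x ^ (1 / p)) * maximalFn n f x} ≤
      2 * bigK n p * ApStarConst n p w ^ (p / (p - 1)) *
        ∫⁻ x, ENNReal.ofReal (|f x| ^ p * w x) := by
  let E : ℕ → Set (Fin n → ℝ) := fun N => {x | ENNReal.ofReal t <
    ENNReal.ofReal (w x ^ (1 / p)) * maximalFn n ((truncSet n N f).indicator f) x}
  have hEm : Monotone E := by
    intro a b hab x hx
    refine lt_of_lt_of_le (show ENNReal.ofReal t < _ from hx) ?_
    gcongr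
    exact maximalFn_mono (trunc_mono n f hab) x
  have hsub : {x | ENNReal.ofReal t < ENNReal.ofReal (w x ^ (1 / p)) * maximalFn n f x} ⊆
      ⋃ N, E N := by
    intro x hx
    have hx : ENNReal.ofReal t < ENNReal.ofReal (w x ^ (1 / p)) * maximalFn n f x := hx
    have h2 := hx.trans_le (mul_le_mul_right (maximalFn_le_iSup hf x) _)
    rw [ENNReal.mul_iSup, lt_iSup_iff] at h2
    exact mem_iUnion.2 h2
  refine (mul_le_mul_right (measure_mono hsub) _).trans ?_
  rw [hEm.measure_iUnion, ENNReal.mul_iSup]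
  refine iSup_le fun N => ?_
  have hfm := hf.indicator (truncSet_meas n N hf)
  have hfi : ∫⁻ y, ENNReal.ofReal |(truncSet n N f).indicator f y| < ∞ := by
    simp_rw [trunc_abs]
    rw [lintegral_indicator (truncSet_meas n N hf)]
    calc _ ≤ ∫⁻ y in truncSet n N f, (N : ℝ≥0∞) := by
          refine setLIntegral_mono measurable_const fun y hy => ?_
          calc _ ≤ ENNReal.ofReal (N : ℝ) := ENNReal.ofReal_le_ofReal hy.2
            _ = N := by simp
      _ = N * volume (truncSet n N f) := by rw [setLIntegral_const]
      _ ≤ N * volume (Metric.closedBall (0 : Fin n → ℝ) N) := by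
          gcongr
          exact inter_subset_left
      _ < ∞ := ENNReal.mul_lt_top (by simp) measure_closedBall_lt_top
  refine (bounded_case hn hp hwm hw0 hw hA hfm hfi
    (fun x => ((maximalFn_trunc_le N f x).trans_lt (by simp)).ne) ht).trans ?_
  refine mul_le_mul_right (lintegral_mono fun x => ENNReal.ofReal_le_ofReal ?_) _
  exact mul_le_mul_of_nonneg_right
    (Real.rpow_le_rpow (abs_nonneg _) (trunc_abs_le_self n N f x) (by linarith)) (hw0 x)

lemma bigK_ne_top (n : ℕ) {p : ℝ} (hp : 1 < p) : bigK n p ≠ ∞ := by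
  have hp0 : 0 ≤ p := by linarith
  have hp1 : 0 ≤ 1 / (p - 1) := by
    have : 0 < p - 1 := by linarith
    positivity
  unfold bigK
  have h5 : (5 ^ n : ℝ≥0∞) ≠ ∞ := by simp
  have h15 : (15 ^ n : ℝ≥0∞) ≠ ∞ := by simp
  have h2 : (2 : ℝ≥0∞) ≠ ∞ := by simp
  refine ENNReal.mul_ne_top (ENNReal.mul_ne_top ?_ ?_) ENNReal.ofReal_ne_top
  · exact ENNReal.rpow_ne_top_of_nonneg hp0 (ENNReal.mul_ne_top h5 (ENNReal.mul_ne_top h2 h15))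
  · exact ENNReal.rpow_ne_top_of_nonneg hp1 (ENNReal.rpow_ne_top_of_nonneg hp0
      (ENNReal.mul_ne_top h2 (ENNReal.mul_ne_top h2 h5)))

/-- Quantitative sufficiency for the Hardy–Littlewood maximal operator:
there is `C = C(n,p) > 0` such that for every `w ∈ A_p^*` and every `f ∈ L^p(w)`,
`‖w^{1/p}·Mf‖_{L^{p,∞}} ≤ C·[w]^{p'/p}·‖f‖_{L^p(w)}`. -/
theorem statement2 (n : ℕ) (hn : 1 ≤ n) (p : ℝ) (hp : 1 < p) :
    ∃ C : ℝ, 0 < C ∧ ∀ w : (Fin n → ℝ) → ℝ, Measurable w → (∀ x, 0 ≤ w x) →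
      (∀ᵐ x ∂(volume : Measure (Fin n → ℝ)), 0 < w x) → ApStarConst n p w < ∞ →
      ∀ f : (Fin n → ℝ) → ℝ, Measurable f →
        (∫⁻ x, ENNReal.ofReal (|f x| ^ p * w x)) < ∞ →
        wnormE n p (fun x => ENNReal.ofReal (w x ^ (1 / p)) * maximalFn n f x) ≤
          ENNReal.ofReal C * ApStarConst n p w ^ ((p / (p - 1)) / p) *
            (∫⁻ x, ENNReal.ofReal (|f x| ^ p * w x)) ^ (1 / p) := by
  have hp0 : 0 < p := by linarith
  have hK : (2 * bigK n p) ^ (1 / p) ≠ ∞ :=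
    ENNReal.rpow_ne_top_of_nonneg (by positivity)
      (ENNReal.mul_ne_top (by simp) (bigK_ne_top n hp))
  refine ⟨((2 * bigK n p) ^ (1 / p)).toReal + 1, by positivity, ?_⟩
  intro w hwm hw0 hw hA f hf _
  unfold wnormE
  refine iSup₂_le fun t ht => ?_
  have key := ENNReal.rpow_le_rpow (general_case hn hp hwm hw0 hw hA hf ht)
    (show 0 ≤ 1 / p by positivity)
  have hq : (0 : ℝ) ≤ 1 / p := by positivity
  rw [ENNReal.mul_rpow_of_nonneg _ _ hq, ENNReal.mul_rpow_of_nonneg _ _ hq,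
    ENNReal.mul_rpow_of_nonneg _ _ hq, ← ENNReal.rpow_mul, ← ENNReal.rpow_mul,
    mul_one_div_cancel hp0.ne', ENNReal.rpow_one, mul_one_div] at key
  refine key.trans ?_
  gcongr
  calc (2 * bigK n p) ^ (1 / p)
      = ENNReal.ofReal ((2 * bigK n p) ^ (1 / p)).toReal := (ENNReal.ofReal_toReal hK).symm
    _ ≤ _ := ENNReal.ofReal_le_ofReal (by linarith)
end
end

section
/- Let n ≥ 1 and 1 < p < ∞, and let w be a weight on ℝⁿ. If there exists a constant C > 0 such that ‖w^{1/p}·Mf‖_{L^{p,∞}} ≤ C·‖f‖_{L^p(w)} for every f ∈ L^p(w), then w ∈ A_p^*. -/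
open MeasureTheory Set
open scoped ENNReal

noncomputable section

lemma aux_pt (p : ℝ) (hp : 1 < p) (w N : ℝ) (hw : 0 ≤ w) (hN : 0 ≤ N) :
    |min (w ^ (1 - p / (p - 1))) N| ^ p * w ≤ min (w ^ (1 - p / (p - 1))) N := by
  set s := w ^ (1 - p / (p - 1)) with hs
  have hs0 : 0 ≤ s := Real.rpow_nonneg hw _
  have hf0 : 0 ≤ min s N := le_min hs0 hN
  rw [abs_of_nonneg hf0]
  rcases hw.eq_or_lt with h | h
  · rw [← h]; simpa using ⟨hs0, hN⟩
  have h1 : (min s N) ^ p = (min s N) ^ (p - 1) * min s N := by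
    rcases hf0.eq_or_lt with h0 | h0
    · rw [← h0, Real.zero_rpow (by linarith)]; simp
    · rw [← Real.rpow_add_one h0.ne']; congr 1; ring
  have h2 : (min s N) ^ (p - 1) ≤ w⁻¹ := by
    calc (min s N) ^ (p - 1) ≤ s ^ (p - 1) :=
          Real.rpow_le_rpow hf0 (min_le_left _ _) (by linarith)
      _ = w⁻¹ := by
          rw [hs, ← Real.rpow_mul hw, ← Real.rpow_neg_one]
          congr 1
          have : p - 1 ≠ 0 := by linarith
          field_simp
          ring
  calc (min s N) ^ p * w = (min s N) ^ (p - 1) * (min s N * w) := by rw [h1]; ring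
    _ ≤ w⁻¹ * (min s N * w) := by gcongr
    _ = min s N := by field_simp

lemma aux_alg (p : ℝ) (hp : 1 < p) (T V F v c : ℝ≥0∞) (hF0 : F ≠ 0) (hF : F ≠ ∞)
    (hv0 : v ≠ 0) (hv : v ≠ ∞)
    (h : T ^ (1 / p) * (v⁻¹ * F) * V ^ (1 / p) ≤ c * F ^ (1 / p)) :
    v⁻¹ * (T * V) * (v⁻¹ * F) ^ (p - 1) ≤ c ^ p := by
  have hp0 : 0 < p := by linarith
  have h1 := ENNReal.rpow_le_rpow h hp0.le
  rw [ENNReal.mul_rpow_of_nonneg (T ^ (1 / p) * (v⁻¹ * F)) _ hp0.le,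
    ENNReal.mul_rpow_of_nonneg (T ^ (1 / p)) _ hp0.le,
    ENNReal.mul_rpow_of_nonneg c _ hp0.le, ← ENNReal.rpow_mul, ← ENNReal.rpow_mul,
    ← ENNReal.rpow_mul, one_div_mul_cancel hp0.ne', ENNReal.rpow_one, ENNReal.rpow_one,
    ENNReal.rpow_one] at h1
  have hA0 : v⁻¹ * F ≠ 0 := mul_ne_zero (by simpa using hv) hF0
  have hA : v⁻¹ * F ≠ ∞ := ENNReal.mul_ne_top (by simpa using hv0) hF
  have h2 : (v⁻¹ * F) ^ p = (v⁻¹ * F) ^ (p - 1) * (v⁻¹ * F) := by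
    have h3 := ENNReal.rpow_add (p - 1) 1 hA0 hA
    rwa [ENNReal.rpow_one, sub_add_cancel] at h3
  rw [h2] at h1
  rw [← ENNReal.mul_le_mul_iff_left hF0 hF]
  calc _ = T * ((v⁻¹ * F) ^ (p - 1) * (v⁻¹ * F)) * V := by ring
    _ ≤ _ := h1

lemma aux_main (n : ℕ) (p : ℝ) (hp : 1 < p)
    (w : (Fin n → ℝ) → ℝ) (hwm : Measurable w) (hw0 : ∀ x, 0 ≤ w x) (C : ℝ)
    (hb : ∀ f : (Fin n → ℝ) → ℝ, Measurable f →
        (∫⁻ x, ENNReal.ofReal (|f x| ^ p * w x)) < ∞ →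
        wnormE n p (fun x => ENNReal.ofReal (w x ^ (1 / p)) * maximalFn n f x) ≤
          ENNReal.ofReal C * (∫⁻ x, ENNReal.ofReal (|f x| ^ p * w x)) ^ (1 / p))
    (Q : Set (Fin n → ℝ)) (hQ : IsCube n Q) (hQm : MeasurableSet Q)
    (hv0 : volume Q ≠ 0) (hv : volume Q ≠ ∞) (t : ℝ) (ht : 0 < t) (N : ℕ) :
    (volume Q)⁻¹ * (ENNReal.ofReal t * volume (Q ∩ {x | t < w x})) *
      ((volume Q)⁻¹ * ∫⁻ x in Q, ENNReal.ofReal (min (w x ^ (1 - p / (p - 1))) N)) ^ (p - 1)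
      ≤ ENNReal.ofReal C ^ p := by
  have hp0 : 0 < p := by linarith
  set g : (Fin n → ℝ) → ℝ := fun x => min (w x ^ (1 - p / (p - 1))) N with hg
  have hg0 : ∀ x, 0 ≤ g x := fun x => le_min (Real.rpow_nonneg (hw0 x) _) (Nat.cast_nonneg N)
  have hgm : Measurable g := (hwm.pow_const _).min measurable_const
  set F : ℝ≥0∞ := ∫⁻ x in Q, ENNReal.ofReal (g x) with hFd
  change (volume Q)⁻¹ * _ * ((volume Q)⁻¹ * F) ^ (p - 1) ≤ _
  have hF : F ≠ ∞ := by
    have : F ≤ ∫⁻ x in Q, ENNReal.ofReal N :=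
      lintegral_mono fun x => ENNReal.ofReal_le_ofReal (min_le_right _ _)
    rw [setLIntegral_const] at this
    exact ne_top_of_le_ne_top (ENNReal.mul_ne_top ENNReal.ofReal_ne_top hv) this
  by_cases hF0 : F = 0
  · rw [hF0, mul_zero, ENNReal.zero_rpow_of_pos (by linarith), mul_zero]; exact zero_le
  set f := Q.indicator g with hf
  have hfm : Measurable f := hgm.indicator hQm
  have hI : (∫⁻ x, ENNReal.ofReal (|f x| ^ p * w x)) ≤ F := by
    rw [hFd, ← lintegral_indicator hQm]
    refine lintegral_mono fun x => ?_
    by_cases hx : x ∈ Q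
    · simp only [hf, indicator_of_mem hx]
      exact ENNReal.ofReal_le_ofReal (aux_pt p hp (w x) N (hw0 x) (Nat.cast_nonneg N))
    · simp [hf, indicator_of_notMem hx, Real.zero_rpow hp0.ne']
  have hb1 := hb f hfm (hI.trans_lt hF.lt_top)
  have hA0 : (volume Q)⁻¹ * F ≠ 0 := mul_ne_zero (by simpa using hv) hF0
  have hA : (volume Q)⁻¹ * F ≠ ∞ := ENNReal.mul_ne_top (by simpa using hv0) hF
  have hM : ∀ x ∈ Q, (volume Q)⁻¹ * F ≤ maximalFn n f x := by
    intro x hx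
    have : F = ∫⁻ y in Q, ENNReal.ofReal |f y| := by
      refine setLIntegral_congr_fun hQm fun y hy => ?_
      simp only [hf, indicator_of_mem hy, abs_of_nonneg (hg0 y)]
    rw [this]
    exact le_iSup_of_le Q (le_iSup_of_le hQ (le_iSup_of_le hx le_rfl))
  have htp : 0 < t ^ (1 / p) := Real.rpow_pos_of_pos ht _
  set s : ℝ := t ^ (1 / p) * ((volume Q)⁻¹ * F).toReal with hs
  have hs0 : 0 < s := mul_pos htp (ENNReal.toReal_pos hA0 hA)
  have hsE : ENNReal.ofReal s = ENNReal.ofReal t ^ (1 / p) * ((volume Q)⁻¹ * F) := by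
    rw [hs, ENNReal.ofReal_mul htp.le, ENNReal.ofReal_toReal hA,
      ENNReal.ofReal_rpow_of_pos ht]
  apply aux_alg p hp _ _ F _ _ hF0 hF hv0 hv
  rw [← hsE]
  calc _ ≤ ENNReal.ofReal s * volume {x | ENNReal.ofReal s <
          ENNReal.ofReal (w x ^ (1 / p)) * maximalFn n f x} ^ (1 / p) := by
        gcongr
        rintro x ⟨hxQ, hxt⟩
        simp only [mem_ofPred_eq] at hxt ⊢
        refine lt_of_lt_of_le ?_ (mul_le_mul_right (hM x hxQ) _)
        rw [hs, ENNReal.ofReal_mul htp.le, ENNReal.ofReal_toReal hA]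
        refine ENNReal.mul_lt_mul_left hA0 hA ?_
        exact (ENNReal.ofReal_lt_ofReal_iff (Real.rpow_pos_of_pos (ht.trans hxt) _)).2
          (Real.rpow_lt_rpow ht.le hxt (by positivity))
    _ ≤ wnormE n p (fun x => ENNReal.ofReal (w x ^ (1 / p)) * maximalFn n f x) :=
        le_iSup_of_le s (le_iSup_of_le hs0 le_rfl)
    _ ≤ _ := hb1
    _ ≤ _ := by gcongr

/-- Necessity for the Hardy–Littlewood maximal operator: if the multiplier
weak-type inequality `‖w^{1/p}·Mf‖_{L^{p,∞}} ≤ C·‖f‖_{L^p(w)}` holds for all `f ∈ L^p(w)`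
for some `C > 0`, then `w ∈ A_p^*`. -/
theorem statement4 (n : ℕ) (hn : 1 ≤ n) (p : ℝ) (hp : 1 < p)
    (w : (Fin n → ℝ) → ℝ) (hwm : Measurable w) (hw0 : ∀ x, 0 ≤ w x)
    (hwpos : ∀ᵐ x ∂(volume : Measure (Fin n → ℝ)), 0 < w x)
    (hbound : ∃ C : ℝ, 0 < C ∧ ∀ f : (Fin n → ℝ) → ℝ, Measurable f →
        (∫⁻ x, ENNReal.ofReal (|f x| ^ p * w x)) < ∞ →
        wnormE n p (fun x => ENNReal.ofReal (w x ^ (1 / p)) * maximalFn n f x) ≤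
          ENNReal.ofReal C * (∫⁻ x, ENNReal.ofReal (|f x| ^ p * w x)) ^ (1 / p)) :
    ApStarConst n p w < ∞ := by
  obtain ⟨C, hC, hb⟩ := hbound
  refine lt_of_le_of_lt (b := ENNReal.ofReal C ^ p) ?_
    (ENNReal.rpow_lt_top_of_nonneg (by linarith) ENNReal.ofReal_ne_top)
  refine iSup_le fun Q => iSup_le fun hQ => ?_
  obtain ⟨a, h, hh, hQe⟩ := id hQ
  have hQm : MeasurableSet Q := by
    rw [hQe]; exact MeasurableSet.univ_pi fun i => measurableSet_Icc
  have hvol : volume Q = ENNReal.ofReal h ^ n := by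
    rw [hQe, volume_pi_pi]; simp
  have hv0 : volume Q ≠ 0 := by
    rw [hvol]; exact pow_ne_zero _ (by simpa using hh)
  have hv : volume Q ≠ ∞ := by
    rw [hvol]; exact ENNReal.pow_ne_top ENNReal.ofReal_ne_top
  rw [wnormE]
  simp only [ENNReal.mul_iSup, ENNReal.iSup_mul]
  refine iSup_le fun t => iSup_le fun ht => ?_
  have hset : {x | ENNReal.ofReal t < Q.indicator (fun x => ENNReal.ofReal (w x)) x}
      = Q ∩ {x | t < w x} := by
    ext x
    by_cases hx : x ∈ Q
    · simp only [mem_ofPred_eq, indicator_of_mem hx, mem_inter_iff, hx, true_and]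
      exact ENNReal.ofReal_lt_ofReal_iff_of_nonneg ht.le
    · simp [hx]
  rw [hset, div_one, ENNReal.rpow_one]
  have hlim : Filter.Tendsto (fun N : ℕ => ∫⁻ x in Q,
      ENNReal.ofReal (min (w x ^ (1 - p / (p - 1))) N)) Filter.atTop
      (nhds (∫⁻ x in Q, ENNReal.ofReal (w x ^ (1 - p / (p - 1))))) := by
    refine lintegral_tendsto_of_tendsto_of_monotone
      (fun N => (((hwm.pow_const _).min measurable_const).ennreal_ofReal).aemeasurable)
      (Filter.Eventually.of_forall fun x N M hNM => ?_)
      (Filter.Eventually.of_forall fun x => ?_)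
    · exact ENNReal.ofReal_le_ofReal (min_le_min le_rfl (by exact_mod_cast hNM))
    · refine tendsto_const_nhds.congr' ?_
      obtain ⟨M, hM⟩ := exists_nat_ge (w x ^ (1 - p / (p - 1)))
      filter_upwards [Filter.eventually_ge_atTop M] with N hN
      rw [min_eq_left (hM.trans (by exact_mod_cast hN))]
  have hEf : volume (Q ∩ {x | t < w x}) ≠ ∞ :=
    ne_top_of_le_ne_top hv (measure_mono inter_subset_left)
  have hvi : (volume Q)⁻¹ ≠ ∞ := by simpa using hv0
  have hk : (volume Q)⁻¹ * (ENNReal.ofReal t * volume (Q ∩ {x | t < w x})) ≠ ∞ :=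
    ENNReal.mul_ne_top hvi (ENNReal.mul_ne_top ENNReal.ofReal_ne_top hEf)
  have hlim2 := ENNReal.Tendsto.const_mul (((ENNReal.continuous_rpow_const (y := p - 1)).tendsto _).comp
    (ENNReal.Tendsto.const_mul hlim (Or.inr hvi))) (Or.inr hk)
  exact le_of_tendsto' hlim2 fun N => aux_main n p hp w hwm hw0 C hb Q hQ hQm hv0 hv t ht N
end
end
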